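/- Let Ĝ^d be a swap-maximal loopy graph whose largest clique K^0 contained in V^0 has exactly d vertices, with d ≥ 3. Then every edge with both endpoints in V^0 has both of its endpoints in K^0. -/

import Mathlib

open scoped Classical

/-- A loopy graph: at most one edge between any two distinct vertices and at most one
self-loop at each vertex, encoded as a symmetric adjacency relation. -/
structure LoopyGraph (V : Type) where
  Adj : V → V → Prop
  symm : ∀ u v : V, Adj u v → Adj v u

namespace LoopyGraph

variable {V : Type}

/-- The neighbors of `u` (vertices other than `u` adjacent to `u`). -/
def nbr (G : LoopyGraph V) (u : V) : Set V := {v | v ≠ u ∧ G.Adj u v}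

/-- Degree of a vertex: each self-loop contributes `2`. -/
noncomputable def deg (G : LoopyGraph V) (u : V) : ℕ :=
  (G.nbr u).ncard + (if G.Adj u u then 2 else 0)

/-- `G₂` is obtained from `G₁` by a single valid double edge swap
`(u,v),(x,y) ⤳ (u,x),(v,y)`: the two removed edges are distinct edges of `G₁`, the two
added edges are distinct and not already present (no multiedge and no doubled
self-loop is created). -/
def DoubleEdgeSwap (G₁ G₂ : LoopyGraph V) : Prop :=
  ∃ u v x y : V,
    G₁.Adj u v ∧ G₁.Adj x y ∧
    s(u, v) ≠ s(x, y) ∧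
    ¬ G₁.Adj u x ∧ ¬ G₁.Adj v y ∧ s(u, x) ≠ s(v, y) ∧
    ∀ a b : V, G₂.Adj a b ↔
      ((G₁.Adj a b ∧ s(a, b) ≠ s(u, v) ∧ s(a, b) ≠ s(x, y)) ∨
        s(a, b) = s(u, x) ∨ s(a, b) = s(v, y))

/-- `G₂` is reachable from `G₁` by a finite sequence of valid double edge swaps. -/
def Reach (G₁ G₂ : LoopyGraph V) : Prop :=
  Relation.ReflTransGen DoubleEdgeSwap G₁ G₂

/-- Vertices at (shortest-path) distance at most `k` from the set of loop-free vertices. -/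
def within (G : LoopyGraph V) : ℕ → Set V
  | 0 => {v | ¬ G.Adj v v}
  | (k + 1) => within G k ∪ {v | ∃ u ∈ within G k, G.Adj v u}

/-- `Vset G 0 = V^0` is the set of vertices with no self-loop; for `k ≥ 1`,
`Vset G k = V^k` is the set of vertices (necessarily carrying a self-loop) whose
shortest-path distance to `V^0` is exactly `k`. -/
def Vset (G : LoopyGraph V) : ℕ → Set V
  | 0 => {v | ¬ G.Adj v v}
  | (k + 1) => within G (k + 1) \ within G k

/-- `V^∞`: vertices (with a self-loop) having no path to `V^0`. -/
def Vinf (G : LoopyGraph V) : Set V := {v | ∀ k : ℕ, v ∉ within G k}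

/-- A set of vertices is a clique when all pairs of distinct members are adjacent. -/
def IsClique (G : LoopyGraph V) (s : Set V) : Prop :=
  ∀ x ∈ s, ∀ y ∈ s, x ≠ y → G.Adj x y

/-- The set of vertices carrying a self-loop. -/
def selfLoops (G : LoopyGraph V) : Set V := {v | G.Adj v v}

/-- The edges of `G` with both endpoints in `V^0`. -/
def V0edges (G : LoopyGraph V) : Set (Sym2 V) :=
  {e | ∃ u v : V, e = s(u, v) ∧ G.Adj u v ∧ u ∈ Vset G 0 ∧ v ∈ Vset G 0}

/-- `Ĝ` is swap-maximal: among all loopy graphs reachable from it by double edge swaps it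
has the maximum number of self-loops, and subject to that the maximum number of edges with
both endpoints in `V^0`. -/
def SwapMaximal (G : LoopyGraph V) : Prop :=
  ∀ H : LoopyGraph V, Reach G H →
    (selfLoops H).ncard ≤ (selfLoops G).ncard ∧
      ((selfLoops H).ncard = (selfLoops G).ncard →
        (V0edges H).ncard ≤ (V0edges G).ncard)

/-- `K` is a largest clique contained in `V^0`, and it has exactly `d` vertices. -/
def LargestV0Clique (G : LoopyGraph V) (K : Set V) (d : ℕ) : Prop :=
  K ⊆ Vset G 0 ∧ IsClique G K ∧ K.ncard = d ∧
    ∀ K' : Set V, K' ⊆ Vset G 0 → IsClique G K' → K'.ncard ≤ d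

/-- Class `Q1`. -/
def Q1 (G : LoopyGraph V) : Prop :=
  ∃ K : Set V, K ⊆ Vset G 0 ∧ 4 ≤ K.ncard ∧ IsClique G K ∧
    (∀ u ∈ Vset G 0, (∀ w ∈ Vset G 0, ¬ G.Adj u w) ∨ u ∈ K) ∧
    IsClique G (Vset G 1 ∪ K) ∧
    Vset G 2 = ∅ ∧ Vinf G = ∅

/-- Class `Q2`. -/
def Q2 (G : LoopyGraph V) : Prop :=
  3 ≤ {u | u ∈ Vset G 0 ∧ (nbr G u ∩ Vset G 0).ncard = 2}.ncard ∧
  (∀ u ∈ Vset G 0,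
      (∀ w ∈ Vset G 0, ¬ G.Adj u w) ∨
        ((nbr G u ∩ Vset G 0).ncard = 2 ∧ ∀ w ∈ Vset G 1, G.Adj u w)) ∧
  IsClique G (Vset G 1) ∧
  (∀ u ∈ Vset G 2, nbr G u = Vset G 1) ∧
  Vset G 3 = ∅ ∧
  (Vinf G = ∅ ∨ (Vset G 1 = ∅ ∧ ∀ u ∈ Vinf G, deg G u = 2))

/-- The graph of loopy graphs `𝒢({k_i})` is connected: any two loopy graphs with degree
sequence `k` are linked by a finite sequence of valid double edge swaps. -/
def GConnected (k : V → ℕ) : Prop :=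
  ∀ G₁ G₂ : LoopyGraph V, (∀ v, deg G₁ v = k v) → (∀ v, deg G₂ v = k v) →
    Reach G₁ G₂

/-- `G₂` is obtained from `G₁` by a single valid triangle-loop swap: either a triangle on
three distinct vertices is replaced by three self-loops, or conversely. -/
def TriangleLoopSwap (G₁ G₂ : LoopyGraph V) : Prop :=
  ∃ u v w : V, u ≠ v ∧ v ≠ w ∧ u ≠ w ∧
    ((G₁.Adj u v ∧ G₁.Adj v w ∧ G₁.Adj w u ∧
        ¬ G₁.Adj u u ∧ ¬ G₁.Adj v v ∧ ¬ G₁.Adj w w ∧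
        ∀ a b : V, G₂.Adj a b ↔
          ((G₁.Adj a b ∧ s(a, b) ≠ s(u, v) ∧ s(a, b) ≠ s(v, w) ∧ s(a, b) ≠ s(w, u)) ∨
            s(a, b) = s(u, u) ∨ s(a, b) = s(v, v) ∨ s(a, b) = s(w, w))) ∨
      (G₁.Adj u u ∧ G₁.Adj v v ∧ G₁.Adj w w ∧
        ¬ G₁.Adj u v ∧ ¬ G₁.Adj v w ∧ ¬ G₁.Adj w u ∧
        ∀ a b : V, G₂.Adj a b ↔
          ((G₁.Adj a b ∧ s(a, b) ≠ s(u, u) ∧ s(a, b) ≠ s(v, v) ∧ s(a, b) ≠ s(w, w)) ∨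
            s(a, b) = s(u, v) ∨ s(a, b) = s(v, w) ∨ s(a, b) = s(w, u))))

/-- Reachability in the augmented graph of loopy graphs `𝒢_△`: a finite sequence of moves,
each a valid double edge swap or a valid triangle-loop swap. -/
def ReachTri (G₁ G₂ : LoopyGraph V) : Prop :=
  Relation.ReflTransGen
    (fun H₁ H₂ => DoubleEdgeSwap H₁ H₂ ∨ TriangleLoopSwap H₁ H₂) G₁ G₂

/-- `S` is a set of highest-degree vertices for the degree sequence `k`. -/
def TopSet (k : V → ℕ) (S : Set V) : Prop :=
  ∀ u ∈ S, ∀ v : V, v ∉ S → k v ≤ k u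

/-- A loopy graph is simple when it has no self-loops. -/
def IsSimple (G : LoopyGraph V) : Prop := ∀ v : V, ¬ G.Adj v v

/-- `k` is the degree sequence of some simple graph. -/
def SimpleGraphical (k : V → ℕ) : Prop :=
  ∃ G : LoopyGraph V, IsSimple G ∧ ∀ v, deg G v = k v

/-- `k` is `m`-simple-graphical: subtracting `2` from each of the `m` largest entries
yields a simple-graphical sequence. -/
def MSimpleGraphical (k : V → ℕ) (m : ℕ) : Prop :=
  ∃ S : Set V, S.ncard = m ∧ TopSet k S ∧ (∀ v ∈ S, 2 ≤ k v) ∧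
    SimpleGraphical (fun v : V => if v ∈ S then k v - 2 else k v)

/-- `m` is `m*`, the maximum `m` for which the sequence is `m`-simple-graphical. -/
def IsMStar (k : V → ℕ) (m : ℕ) : Prop :=
  MSimpleGraphical k m ∧ ∀ m' : ℕ, MSimpleGraphical k m' → m' ≤ m

/-- `G` is `m`-loopy: it has self-loops exactly at `m` highest-degree vertices. -/
def MLoopy (G : LoopyGraph V) (m : ℕ) : Prop :=
  (selfLoops G).ncard = m ∧ TopSet (deg G) (selfLoops G)

end LoopyGraph

namespace LoopyGraph

variable {V : Type}

/-- The loopy graph obtained from `G` by replacing `(u,v)` and `(x,y)` by `(u,x)` and `(v,y)`. -/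
def swap (G : LoopyGraph V) (u v x y : V) : LoopyGraph V where
  Adj a b := (G.Adj a b ∧ s(a, b) ≠ s(u, v) ∧ s(a, b) ≠ s(x, y)) ∨
    s(a, b) = s(u, x) ∨ s(a, b) = s(v, y)
  symm a b h := by
    rw [Sym2.eq_swap (a := b) (b := a)]
    exact h.imp_left fun h => ⟨G.symm _ _ h.1, h.2⟩

lemma swap_adj (G : LoopyGraph V) (u v x y a b : V) :
    (G.swap u v x y).Adj a b ↔ (G.Adj a b ∧ s(a, b) ≠ s(u, v) ∧ s(a, b) ≠ s(x, y)) ∨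
      s(a, b) = s(u, x) ∨ s(a, b) = s(v, y) := Iff.rfl

lemma doubleEdgeSwap_swap (G : LoopyGraph V) {u v x y : V} (huv : G.Adj u v) (hxy : G.Adj x y)
    (hne : s(u, v) ≠ s(x, y)) (hux : ¬ G.Adj u x) (hvy : ¬ G.Adj v y)
    (hne' : s(u, x) ≠ s(v, y)) : DoubleEdgeSwap G (G.swap u v x y) :=
  ⟨u, v, x, y, huv, hxy, hne, hux, hvy, hne', fun _ _ => Iff.rfl⟩

/-- An induced path `u - v - w` with `v` loop-free can be swapped for a loop at `v` and the
edge `(u,w)`. -/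
lemma exists_doubleEdgeSwap_selfLoops_eq_insert (G : LoopyGraph V) {u v w : V}
    (hu : G.Adj v u) (hw : G.Adj v w) (hv : ¬ G.Adj v v) (huw : ¬ G.Adj u w) (hne : u ≠ w) :
    ∃ H, DoubleEdgeSwap G H ∧ selfLoops H = insert v (selfLoops G) := by
  have hvu : v ≠ u := by rintro rfl; exact hv hu
  have hvw : v ≠ w := by rintro rfl; exact hv hw
  refine ⟨G.swap v u v w, G.doubleEdgeSwap_swap hu hw ?_ hv huw ?_, ?_⟩
  · simp [hne, hvw]
  · simp [hvu, hvw]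
  · ext a
    simp only [selfLoops, Set.mem_ofPred_eq, Set.mem_insert_iff, swap_adj, Sym2.eq_iff]
    grind

/-- No graph reachable from a swap-maximal graph with as many loops has an induced path whose
middle vertex is loop-free. -/
lemma SwapMaximal.adj_of_reach [Finite V] {G H : LoopyGraph V} (hmax : G.SwapMaximal)
    (hr : Reach G H) (hs : selfLoops H = selfLoops G) {u v w : V} (hu : H.Adj v u)
    (hw : H.Adj v w) (hv : ¬ H.Adj v v) (hne : u ≠ w) : H.Adj u w := by
  by_contra huw
  obtain ⟨H', hswap, hloops⟩ :=
    H.exists_doubleEdgeSwap_selfLoops_eq_insert hu hw hv huw hne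
  have hle := (hmax H' (hr.tail hswap)).1
  rw [hloops, Set.ncard_insert_of_notMem (show v ∉ selfLoops H from hv) (Set.toFinite _),
    hs] at hle
  omega

/-- A `V^0`-neighbor of a vertex of a largest clique in `V^0` lies in that clique. -/
lemma SwapMaximal.mem_of_adj [Finite V] {G : LoopyGraph V} (hmax : G.SwapMaximal) {K : Set V}
    {d : ℕ} (hK : LargestV0Clique G K d) {a b : V} (hab : G.Adj a b) (ha : a ∈ K)
    (hb : b ∈ Vset G 0) : b ∈ K := by
  obtain ⟨hK0, hcl, hcard, hlargest⟩ := hK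
  by_contra hbK
  have hadj : ∀ x ∈ K, G.Adj x b := by
    intro x hx
    by_cases hxa : x = a
    · rwa [hxa]
    · exact hmax.adj_of_reach .refl rfl (hcl a ha x hx (Ne.symm hxa)) hab (hK0 ha)
        (fun h => hbK (h ▸ hx))
  have hle := hlargest (insert b K) (Set.insert_subset hb hK0) (by
    rintro x (rfl | hx) y (rfl | hy) hxy
    · exact absurd rfl hxy
    · exact G.symm _ _ (hadj y hy)
    · exact hadj x hx
    · exact hcl x hx y hy hxy)
  rw [Set.ncard_insert_of_notMem hbK (Set.toFinite _)] at hle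
  omega

end LoopyGraph

/-- In a swap-maximal loopy graph `Ĝ^d` with `d ≥ 3`, every edge with both
endpoints in `V^0` has both endpoints in `K^0`. -/
theorem swap_maximal_V0_edges_in_K0 {V : Type} [Fintype V] (G : LoopyGraph V)
    (hmax : G.SwapMaximal) (K : Set V) (d : ℕ) (hd : 3 ≤ d)
    (hK : LoopyGraph.LargestV0Clique G K d) :
    ∀ a b : V, G.Adj a b → a ∈ LoopyGraph.Vset G 0 → b ∈ LoopyGraph.Vset G 0 →
      a ∈ K ∧ b ∈ K := by
  intro a b hab ha hb
  by_cases haK : a ∈ K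
  · exact ⟨haK, hmax.mem_of_adj hK hab haK hb⟩
  by_cases hbK : b ∈ K
  · exact ⟨hmax.mem_of_adj hK (G.symm _ _ hab) hbK ha, hbK⟩
  exfalso
  have hnot_a : ∀ x ∈ K, ¬ G.Adj x a := fun x hx h => haK (hmax.mem_of_adj hK h hx ha)
  have hnot_b : ∀ x ∈ K, ¬ G.Adj x b := fun x hx h => hbK (hmax.mem_of_adj hK h hx hb)
  obtain ⟨hK0, hcl, hcard, -⟩ := hK
  obtain ⟨u, v, w, hu, hv, hw, huv, huw, hvw⟩ :=
    (Set.two_lt_ncard_iff (Set.toFinite K)).1 (by omega : 2 < K.ncard)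
  have hau : a ≠ u := fun h => haK (h ▸ hu)
  have hav : a ≠ v := fun h => haK (h ▸ hv)
  have haw : a ≠ w := fun h => haK (h ▸ hw)
  have hbu : b ≠ u := fun h => hbK (h ▸ hu)
  have hbv : b ≠ v := fun h => hbK (h ▸ hv)
  have hbw : b ≠ w := fun h => hbK (h ▸ hw)
  have hu0 : ¬ G.Adj u u := hK0 hu
  have hab' : a ≠ b := by rintro rfl; exact ha hab
  have hswap : LoopyGraph.DoubleEdgeSwap G (G.swap u v a b) :=
    G.doubleEdgeSwap_swap (hcl u hu v hv huv) hab (by simp [hau.symm, hbu.symm])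
      (hnot_a u hu) (hnot_b v hv) (by simp [huv, hbu.symm])
  have hloops : (G.swap u v a b).selfLoops = G.selfLoops := by
    ext x
    simp only [LoopyGraph.selfLoops, Set.mem_ofPred_eq, LoopyGraph.swap_adj, Sym2.eq_iff]
    grind
  have hadj := hmax.adj_of_reach (.single hswap) hloops (u := w) (v := u) (w := a)
    (by simp [LoopyGraph.swap_adj, hcl u hu w hw huw, hvw.symm, huv, hau.symm, hbu.symm])
    (by simp [LoopyGraph.swap_adj]) (by simp [LoopyGraph.swap_adj, hu0, hau.symm, huv]) haw.symm
  have := hnot_a w hw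
  simp only [LoopyGraph.swap_adj, Sym2.eq_iff] at hadj
  grind
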